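/- arXiv:math/9901087 — 2 statements merged into one kernel-verified Lean document; each statement's English description precedes it below -/
import Mathlib

section
/- Let p ≥ 1 be an integer and let w : ℕ → ℍ be a sequence of quaternions with w 0 = 1. Suppose that for every λ in the circle group U(1) ⊂ ℂ there exists a quaternion α(λ) such that (λ : ℍ)^p * (w i) = (w i) * α(λ) for all i. Then necessarily α(λ) = (λ : ℍ)^p for every λ, and every w i lies in the image of ℂ in ℍ. -/
open Quaternion

/-- The standard embedding of the complex numbers into the quaternions,
sending `a + b·i` to the quaternion `a + b·i`. -/
def Complex.toQuat (z : ℂ) : ℍ[ℝ] := ⟨z.re, z.im, 0, 0⟩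

theorem Complex.toQuat_pow (z : ℂ) (n : ℕ) : (z ^ n).toQuat = z.toQuat ^ n :=
  map_pow Quaternion.ofComplex z n

theorem Circle.exists_pow_eq_I {p : ℕ} (hp : p ≠ 0) : ∃ l : Circle, (l : ℂ) ^ p = Complex.I := by
  refine ⟨Circle.exp (Real.pi / 2 / p), ?_⟩
  have hp' : (p : ℂ) ≠ 0 := Nat.cast_ne_zero.mpr hp
  have harg : (p : ℂ) * (((Real.pi / 2 / p : ℝ) : ℂ) * Complex.I) = Real.pi / 2 * Complex.I := by
    push_cast
    field_simp
  rw [Circle.coe_exp, ← Complex.exp_nat_mul, harg, Complex.exp_pi_div_two_mul_I]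

/-- A quaternion commuting with `i` is complex. -/
theorem Complex.exists_eq_toQuat_of_commute_I {q : ℍ[ℝ]} (h : Commute I.toQuat q) :
    ∃ z : ℂ, q = z.toQuat := by
  have hJ := congrArg QuaternionAlgebra.imJ h.eq
  have hK := congrArg QuaternionAlgebra.imK h.eq
  rw [Quaternion.imJ_mul, Quaternion.imJ_mul] at hJ
  rw [Quaternion.imK_mul, Quaternion.imK_mul] at hK
  simp only [Complex.toQuat, I_re, I_im] at hJ hK
  refine ⟨⟨q.re, q.imI⟩, ?_⟩
  ext
  · rfl
  · rfl
  · change q.imJ = 0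
    linarith
  · change q.imK = 0
    linarith

/-- The explicit computation in the proof of Lemma 3.2.8: let `p ≥ 1`, and let
`w : ℕ → ℍ` be a sequence of quaternions with `w 0 = 1` such that for every unit
complex number `λ` there is a quaternion `α λ` with `λ^p * w i = w i * α λ` for
all `i`.  Then `α λ = λ^p` for every `λ`, and every `w i` is complex. -/
theorem fixed_line_is_complex (p : ℕ) (hp : 1 ≤ p) (w : ℕ → ℍ[ℝ]) (hw : w 0 = 1)
    (α : Circle → ℍ[ℝ])
    (h : ∀ l : Circle, ∀ i : ℕ, (Complex.toQuat (l : ℂ)) ^ p * w i = w i * α l) :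
    (∀ l : Circle, α l = (Complex.toQuat (l : ℂ)) ^ p) ∧
      (∀ i : ℕ, ∃ z : ℂ, w i = Complex.toQuat z) := by
  have hα (l : Circle) : α l = (Complex.toQuat (l : ℂ)) ^ p := by
    simpa [hw] using (h l 0).symm
  refine ⟨hα, fun i ↦ Complex.exists_eq_toQuat_of_commute_I ?_⟩
  obtain ⟨l, hl⟩ := Circle.exists_pow_eq_I (Nat.one_le_iff_ne_zero.mp hp)
  rw [← hl, Complex.toQuat_pow]
  exact (h l i).trans (by rw [hα])
end

section
/- Every continuous group homomorphism ρ from the circle group U(1) to the special unitary group SU(2) (2×2 complex special unitary matrices) is conjugate in SU(2) to a standard diagonal homomorphism: there exist a matrix g ∈ SU(2) and a natural number p such that for every λ ∈ U(1), g * ρ(λ) * g⁻¹ is the diagonal matrix with diagonal entries λ^p and λ^{-p}. -/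
/-- A continuous character of the circle is an integral power of the identity. -/
theorem Circle.exists_zpow_of_continuous_monoidHom (χ : Circle →* ℂ) (hχ : Continuous χ) :
    ∃ n : ℤ, ∀ l : Circle, χ l = (l : ℂ) ^ n := by
  let f : C(AddCircle (1 : ℝ), ℂ) :=
    ⟨fun x => χ (AddCircle.toCircle x), hχ.comp AddCircle.continuous_toCircle⟩
  have f_add (s t : AddCircle (1 : ℝ)) : f (t + s) = f t * f s := by
    simp [f, AddCircle.toCircle_add]
  obtain ⟨n, hn⟩ : ∃ n, fourierCoeff f n ≠ 0 := by
    by_contra! h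
    have hs : Summable (fourierCoeff f) := by
      rw [show fourierCoeff f = 0 from funext h]
      exact summable_zero
    have h1 := has_pointwise_sum_fourier_series_of_summable hs 0
    simp only [h, zero_smul] at h1
    have h2 : f 0 = 1 := by simp [f]
    exact one_ne_zero (h2.symm.trans (h1.unique hasSum_zero))
  have key (s : AddCircle (1 : ℝ)) : f s = fourier n s := by
    have h1 : fourierCoeff f n = (fourier (-n) s * f s) * fourierCoeff f n := by
      unfold fourierCoeff
      rw [← MeasureTheory.integral_const_mul]
      conv_lhs => rw [← MeasureTheory.integral_add_right_eq_self _ s]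
      congr 1
      ext t
      simp only [f_add, fourier_apply, smul_add, AddCircle.toCircle_add, Circle.coe_mul,
        smul_eq_mul]
      ring
    have h2 : fourier (-n) s * f s = 1 := mul_right_cancel₀ hn (by rw [← h1, one_mul])
    have h3 : fourier n s * fourier (-n) s = 1 := by
      rw [← fourier_add, add_neg_cancel, fourier_zero]
    calc f s = (fourier n s * fourier (-n) s) * f s := by rw [h3, one_mul]
      _ = fourier n s := by rw [mul_assoc, h2, mul_one]
  refine ⟨n, fun l => ?_⟩
  obtain ⟨x, rfl⟩ : ∃ x : AddCircle (1 : ℝ), AddCircle.toCircle x = l := by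
    refine ⟨(AddCircle.homeomorphCircle one_ne_zero).symm l, ?_⟩
    rw [← AddCircle.homeomorphCircle_apply one_ne_zero, Homeomorph.apply_symm_apply]
  have h := key x
  rw [fourier_apply, AddCircle.toCircle_zsmul, Circle.coe_zpow] at h
  exact h

namespace Matrix

open ComplexConjugate

/-- A complex unit vector `(a, b)` is the first column of the inverse of this matrix in `SU(2)`. -/
theorem mem_specialUnitaryGroup_of_unit_vector {a b : ℂ} (h : a * conj a + b * conj b = 1) :
    !![conj a, conj b; -b, a] ∈ specialUnitaryGroup (Fin 2) ℂ := by
  refine mem_specialUnitaryGroup_iff.2 ⟨mem_unitaryGroup_iff.2 ?_, ?_⟩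
  · ext i j
    fin_cases i <;> fin_cases j <;>
      simp [star_eq_conjTranspose, mul_apply, Fin.sum_univ_two] <;>
      first | ring1 | linear_combination h
  · rw [det_fin_two_of]
    linear_combination h

theorem star_eq_adjugate_of_mem_specialUnitaryGroup {n : Type*} [Fintype n] [DecidableEq n]
    {A : Matrix n n ℂ} (hA : A ∈ specialUnitaryGroup n ℂ) : star A = A.adjugate := by
  have hu := mem_unitaryGroup_iff'.1 hA.1
  have h := A.mul_adjugate
  rw [(mem_specialUnitaryGroup_iff.1 hA).2, one_smul] at h
  calc star A = star A * (A * A.adjugate) := by rw [h, mul_one]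
    _ = A.adjugate := by rw [← mul_assoc, hu, one_mul]

theorem exists_unit_eigenvector_fin_two (M : Matrix (Fin 2) (Fin 2) ℂ) :
    ∃ (μ : ℂ) (v : Fin 2 → ℂ), v 0 * conj (v 0) + v 1 * conj (v 1) = 1 ∧ M *ᵥ v = μ • v := by
  obtain ⟨μ, hμ⟩ := Module.End.exists_eigenvalue (toLin' M)
  obtain ⟨w, hw⟩ := hμ.exists_hasEigenvector
  have hMw : M *ᵥ w = μ • w := by simpa using hw.apply_eq_smul
  set r : ℝ := Complex.normSq (w 0) + Complex.normSq (w 1) with hr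
  have hr0 : 0 < r := by
    refine lt_of_le_of_ne (add_nonneg (Complex.normSq_nonneg _) (Complex.normSq_nonneg _)) ?_
    intro h0
    refine hw.2 (funext fun i => ?_)
    have h1 := Complex.normSq_nonneg (w 0)
    have h2 := Complex.normSq_nonneg (w 1)
    fin_cases i <;> refine Complex.normSq_eq_zero.1 ?_ <;> simp only [Fin.zero_eta, Fin.mk_one] <;>
      linarith
  have hs : ((√r : ℝ) : ℂ) ^ 2 = r := by exact_mod_cast Real.sq_sqrt hr0.le
  have hs0 : ((√r : ℝ) : ℂ) ≠ 0 := by exact_mod_cast (Real.sqrt_pos.2 hr0).ne'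
  refine ⟨μ, ((√r : ℝ) : ℂ)⁻¹ • w, ?_, ?_⟩
  · have h : w 0 * conj (w 0) + w 1 * conj (w 1) = ((√r : ℝ) : ℂ) ^ 2 := by
      rw [hs, hr, Complex.mul_conj, Complex.mul_conj]
      push_cast
      rfl
    simp only [Pi.smul_apply, smul_eq_mul, map_mul, map_inv₀, Complex.conj_ofReal]
    field_simp
    exact h
  · rw [mulVec_smul, hMw, smul_comm]

/-- Two vectors in one eigenspace of a non-scalar `2 × 2` matrix are parallel. -/
theorem mul_eq_mul_of_mulVec_eq_smul {M : Matrix (Fin 2) (Fin 2) ℂ} {μ : ℂ} {v w : Fin 2 → ℂ}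
    (hM : M ≠ scalar (Fin 2) μ) (hv : M *ᵥ v = μ • v) (hw : M *ᵥ w = μ • w) :
    w 0 * v 1 = w 1 * v 0 := by
  by_contra hne
  have hd : w 0 * v 1 - w 1 * v 0 ≠ 0 := sub_ne_zero.2 hne
  have hv' (i : Fin 2) : M i 0 * v 0 + M i 1 * v 1 = μ * v i := by
    simpa [mulVec, dotProduct, Fin.sum_univ_two] using congrFun hv i
  have hw' (i : Fin 2) : M i 0 * w 0 + M i 1 * w 1 = μ * w i := by
    simpa [mulVec, dotProduct, Fin.sum_univ_two] using congrFun hw i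
  refine hM ?_
  ext i j
  fin_cases i <;> fin_cases j <;> refine mul_right_cancel₀ hd ?_ <;>
    simp [-mul_eq_mul_right_iff, -mul_eq_zero]
  · linear_combination v 1 * hw' 0 - w 1 * hv' 0
  · linear_combination w 0 * hv' 0 - v 0 * hw' 0
  · linear_combination v 1 * hw' 1 - w 1 * hv' 1
  · linear_combination w 0 * hv' 1 - v 0 * hw' 1

/-- A commuting family of `2 × 2` complex matrices can be simultaneously triangularized by an
element of `SU(2)`. -/
theorem exists_specialUnitary_triangularizing {ι : Type*} (A : ι → Matrix (Fin 2) (Fin 2) ℂ)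
    (hA : ∀ i j, Commute (A i) (A j)) :
    ∃ g ∈ specialUnitaryGroup (Fin 2) ℂ, ∀ i, (g * A i * star g) 1 0 = 0 := by
  by_cases hsc : ∀ i, ∃ μ, A i = scalar (Fin 2) μ
  · refine ⟨1, one_mem _, fun i => ?_⟩
    obtain ⟨μ, hμ⟩ := hsc i
    simp [hμ]
  · push Not at hsc
    obtain ⟨k, hk⟩ := hsc
    obtain ⟨μ, v, hv1, hv⟩ := exists_unit_eigenvector_fin_two (A k)
    refine ⟨_, mem_specialUnitaryGroup_of_unit_vector hv1, fun i => ?_⟩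
    have hw : A k *ᵥ (A i *ᵥ v) = μ • (A i *ᵥ v) := by
      rw [mulVec_mulVec, (hA k i).eq, ← mulVec_mulVec, hv, mulVec_smul]
    have h := mul_eq_mul_of_mulVec_eq_smul (hk μ) hv hw
    simp only [mulVec, dotProduct, Fin.sum_univ_two] at h
    simp [star_eq_conjTranspose, mul_apply, vecMul, dotProduct, Fin.sum_univ_two]
    linear_combination -h

theorem eq_diagonal_of_mem_specialUnitaryGroup {B : Matrix (Fin 2) (Fin 2) ℂ}
    (hB : B ∈ specialUnitaryGroup (Fin 2) ℂ) (h : B 1 0 = 0) :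
    B = diagonal ![B 0 0, (B 0 0)⁻¹] := by
  have h01 : B 0 1 = 0 := by
    have h2 := congrFun (congrFun (star_eq_adjugate_of_mem_specialUnitaryGroup hB) 0) 1
    simpa [adjugate_fin_two, star_eq_conjTranspose, h, eq_comm] using h2
  have hdet : B 0 0 * B 1 1 = 1 := by
    have h2 := (mem_specialUnitaryGroup_iff.1 hB).2
    rwa [det_fin_two, h, mul_zero, sub_zero] at h2
  ext i j
  fin_cases i <;> fin_cases j <;> simp [h, h01, eq_inv_of_mul_eq_one_right hdet]

end Matrix

open Matrix in

/-- Every continuous homomorphism from the circle group `U(1)` to `SU(2)` is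
conjugate in `SU(2)` to a standard diagonal homomorphism `λ ↦ diag (λ^p, λ^{-p})`
for some natural number `p` (the "mass"). -/
theorem circle_hom_SU2_conjugate_diagonal
    (ρ : Circle →* Matrix.specialUnitaryGroup (Fin 2) ℂ)
    (hρ : Continuous ρ) :
    ∃ g : Matrix (Fin 2) (Fin 2) ℂ, g ∈ Matrix.specialUnitaryGroup (Fin 2) ℂ ∧
      ∃ p : ℕ, ∀ l : Circle,
        g * ((ρ l : Matrix.specialUnitaryGroup (Fin 2) ℂ) : Matrix (Fin 2) (Fin 2) ℂ) * g⁻¹ =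
          Matrix.diagonal ![(l : ℂ) ^ p, ((l : ℂ) ^ p)⁻¹] := by
  obtain ⟨g, hg, hgρ⟩ := exists_specialUnitary_triangularizing
    (fun l => (ρ l : Matrix (Fin 2) (Fin 2) ℂ)) fun l m => by
      simp only [Commute, SemiconjBy, ← Submonoid.coe_mul, ← map_mul, mul_comm l m]
  have hgg : g * star g = 1 := mem_unitaryGroup_iff.1 hg.1
  have hgg' : star g * g = 1 := mem_unitaryGroup_iff'.1 hg.1
  have hB (l : Circle) := eq_diagonal_of_mem_specialUnitaryGroup
    (mul_mem (mul_mem hg (ρ l).2) (star (⟨g, hg⟩ : specialUnitaryGroup (Fin 2) ℂ)).2) (hgρ l)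
  let χ : Circle →* ℂ :=
    { toFun := fun l => (g * (ρ l : Matrix (Fin 2) (Fin 2) ℂ) * star g) 0 0
      map_one' := by simp [hgg]
      map_mul' := fun l m => by
        have h : g * (ρ (l * m) : Matrix (Fin 2) (Fin 2) ℂ) * star g =
            (g * (ρ l : Matrix (Fin 2) (Fin 2) ℂ) * star g) *
              (g * (ρ m : Matrix (Fin 2) (Fin 2) ℂ) * star g) := by
          simp only [map_mul, Submonoid.coe_mul, mul_assoc]
          rw [← mul_assoc (star g) g, hgg', one_mul]
        rw [h, mul_apply, Fin.sum_univ_two, hgρ m, mul_zero, add_zero] }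
  have hχ : Continuous χ :=
    ((continuous_const.mul (continuous_subtype_val.comp hρ)).mul continuous_const).matrix_elem 0 0
  obtain ⟨n, hn⟩ := Circle.exists_zpow_of_continuous_monoidHom χ hχ
  have hD (l : Circle) : g * (ρ l : Matrix (Fin 2) (Fin 2) ℂ) * star g =
      diagonal ![(l : ℂ) ^ n, ((l : ℂ) ^ n)⁻¹] := by
    rw [← hn l]
    exact hB l
  obtain ⟨p, rfl | rfl⟩ := n.eq_nat_or_neg
  · refine ⟨g, hg, p, fun l => ?_⟩
    rw [inv_eq_right_inv hgg, hD l, zpow_natCast]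
  · have hJ : (!![0, 1; -1, 0] : Matrix (Fin 2) (Fin 2) ℂ) ∈ specialUnitaryGroup (Fin 2) ℂ := by
      simpa using mem_specialUnitaryGroup_of_unit_vector (a := 0) (b := 1) (by simp)
    have hJg := mul_mem hJ hg
    refine ⟨_, hJg, p, fun l => ?_⟩
    rw [inv_eq_right_inv (mem_unitaryGroup_iff.1 hJg.1), star_mul]
    calc _ = !![0, 1; -1, 0] * (g * (ρ l : Matrix (Fin 2) (Fin 2) ℂ) * star g) *
          star !![0, 1; -1, 0] := by simp only [mul_assoc]
      _ = _ := by
        rw [hD l, _root_.zpow_neg, zpow_natCast]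
        ext i j
        fin_cases i <;> fin_cases j <;>
          simp [star_eq_conjTranspose, mul_apply, vecMul_diagonal, Fin.sum_univ_two]
end
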